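/- There are absolute constants c₁, c₂ > 0 for which the following holds. Let w be a symmetric random variable with variance 1 satisfying ℙ(|w| ≥ 0.1) ≥ 0.1, and suppose w has an atom of size η > 0, i.e. ℙ(w = t₀) = η for some t₀ ∈ ℝ. Then for every m ≥ c₁/η² there exist d ∈ ℕ and a set A ⊂ S^{d−1} satisfying γ₁(A) ≤ 10 such that, with X the random vector in ℝ^d whose coordinates are independent copies of w and X₁,…,X_m independent copies of X, ℙ( sup_{x∈A} ‖F_{m,x} − F_x‖_{L∞} ≥ c₂ · η ) ≥ 0.9. -/

import Mathlib

open MeasureTheory Real Set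

noncomputable section

/-- The empirical distribution function of the sample `xs`. -/
def empCDF {m : ℕ} (xs : Fin m → ℝ) (t : ℝ) : ℝ :=
  ((Finset.univ.filter fun i => xs i ≤ t).card : ℝ) / m

/-- The distribution function of `h(X)` where `X ∼ μ`. -/
def cdfOf {𝒳 : Type*} [MeasurableSpace 𝒳] (μ : Measure 𝒳) (h : 𝒳 → ℝ) (t : ℝ) : ℝ :=
  (μ {x | h x ≤ t}).toReal

/-- The L²(μ) distance between two functions. -/
def L2dist {𝒳 : Type*} [MeasurableSpace 𝒳] (μ : Measure 𝒳) (h g : 𝒳 → ℝ) : ℝ :=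
  Real.sqrt (∫ x, (h x - g x) ^ 2 ∂μ)

/-- An admissible sequence of subsets of `H`: `|T 0| = 1` and `|T s| ≤ 2^(2^s)` for `s ≥ 1`. -/
def IsAdmissible {E : Type*} (H : Set E) (T : ℕ → Set E) : Prop :=
  (∀ s, T s ⊆ H) ∧ (∀ s, (T s).Finite) ∧ (∀ s, (T s).Nonempty) ∧
    (T 0).ncard = 1 ∧ ∀ s, 1 ≤ s → (T s).ncard ≤ 2 ^ 2 ^ s

/-- Talagrand's γ₁ functional of `H` with respect to the distance `dist`:
the infimum over admissible sequences of `sup_{h ∈ H} ∑_s 2^s · dist(h, T s)`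
(the sum of the nonnegative series being expressed through its partial sums). -/
def gamma1 {E : Type*} (dist : E → E → ℝ) (H : Set E) : ℝ :=
  sInf { r : ℝ | ∃ T : ℕ → Set E, IsAdmissible H T ∧
    ∀ h ∈ H, ∀ n : ℕ, ∑ s ∈ Finset.range n, (2 : ℝ) ^ s * sInf (dist h '' T s) ≤ r }

/-- Generalized inverse of a distribution function. -/
def quantileFn (F : ℝ → ℝ) (u : ℝ) : ℝ := sInf {t | u ≤ F t}

/-- Assumption (A): every `h ∈ H` has mean zero and variance one; increments have
subexponential tails with constant `L`; and each `h(X)` has a density bounded by `D`. -/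
def AssumptionA {𝒳 : Type*} [MeasurableSpace 𝒳] (μ : Measure 𝒳) (H : Set (𝒳 → ℝ))
    (L D : ℝ) : Prop :=
  (∀ h ∈ H, Measurable h) ∧
  (∀ h ∈ H, ∫ x, h x ∂μ = 0) ∧
  (∀ h ∈ H, ∫ x, (h x) ^ 2 ∂μ = 1) ∧
  (∀ h ∈ insert 0 H, ∀ g ∈ insert 0 H, ∀ t : ℝ, 0 < t →
    μ {x | t * L * L2dist μ h g ≤ |h x - g x|} ≤ ENNReal.ofReal (2 * Real.exp (-t))) ∧
  (∀ h ∈ H, ∃ f : ℝ → ℝ, (∀ t, 0 ≤ f t ∧ f t ≤ D) ∧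
    Measure.map h μ = (volume : Measure ℝ).withDensity fun t => ENNReal.ofReal (f t))

/-- Euclidean distance on `Fin d → ℝ`. -/
def euclDist {d : ℕ} (x y : Fin d → ℝ) : ℝ := Real.sqrt (∑ i, (x i - y i) ^ 2)

/-- The Euclidean unit sphere in `Fin d → ℝ`. -/
def unitSphere (d : ℕ) : Set (Fin d → ℝ) := {x | ∑ i, (x i) ^ 2 = 1}

/-- The Euclidean inner product on `Fin d → ℝ`. -/
def dotp {d : ℕ} (v x : Fin d → ℝ) : ℝ := ∑ i, v i * x i

open ProbabilityTheory Filter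
open scoped Topology

/-- Indicators of independent sets are independent random variables. -/
lemma indepFun_indicator_one_of_indepSet {Ω : Type*} [MeasurableSpace Ω] {P : Measure Ω}
    {s t : Set Ω} (h : IndepSet s t P) :
    IndepFun (s.indicator (1 : Ω → ℝ)) (t.indicator (1 : Ω → ℝ)) P := by
  have hle : ∀ u : Set Ω, MeasurableSpace.comap (u.indicator (1 : Ω → ℝ)) inferInstance ≤
      MeasurableSpace.generateFrom {u} := by
    intro u
    have hu : Measurable[MeasurableSpace.generateFrom {u}] (u.indicator (1 : Ω → ℝ)) :=
      (@measurable_const ℝ Ω _ (MeasurableSpace.generateFrom {u}) 1).indicator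
        (MeasurableSpace.measurableSet_generateFrom rfl)
    exact hu.comap_le
  exact (IndepFun_iff_Indep _ _ _).2
    (indep_of_indep_of_le_right (indep_of_indep_of_le_left h (hle s)) (hle t))

/-- Chebyshev's inequality for the frequency of pairwise independent, equally likely events. -/
lemma measureReal_abs_frequency_sub_ge_le {Ω : Type*} [MeasurableSpace Ω] (P : Measure Ω)
    [IsProbabilityMeasure P] {n : ℕ} (hn : 0 < n) {E : Fin n → Set Ω}
    (hE : ∀ i, MeasurableSet (E i)) {q : ℝ} (hq : ∀ i, P.real (E i) = q)
    (hind : Pairwise fun i j => IndepSet (E i) (E j) P) {ε : ℝ} (hε : 0 < ε) :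
    P.real {ω | ε ≤ |(∑ i, (E i).indicator 1 ω) / n - q|} ≤ 1 / (n * ε ^ 2) := by
  have hn' : (0 : ℝ) < n := by exact_mod_cast hn
  have hmem : ∀ i ∈ Finset.univ, MemLp ((E i).indicator (1 : Ω → ℝ)) 2 P := fun i _ =>
    (memLp_const (1 : ℝ)).indicator (hE i)
  have hint : ∀ i, ∫ ω, (E i).indicator (1 : Ω → ℝ) ω ∂P = q := fun i => by
    rw [integral_indicator_one (hE i), hq i]
  have hvar : variance (∑ i, (E i).indicator (1 : Ω → ℝ)) P ≤ (n : ℝ) := by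
    rw [IndepFun.variance_sum hmem]
    · calc _ ≤ ∑ _i : Fin n, (((1 : ℝ) - 0) / 2) ^ 2 := by
            refine Finset.sum_le_sum fun i _ => variance_le_sq_of_bounded
              (Eventually.of_forall fun ω => ?_) (hmem i (by simp)).1.aemeasurable
            by_cases h : ω ∈ E i <;> simp [h]
        _ ≤ (n : ℝ) := by simp; linarith
    · intro i _ j _ hij
      exact indepFun_indicator_one_of_indepSet (hind hij)
  have hmean : ∫ ω, (∑ i, (E i).indicator (1 : Ω → ℝ)) ω ∂P = n * q := by
    simp only [Finset.sum_apply]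
    rw [integral_finsetSum _ fun i hi => (hmem i hi).integrable (by norm_num)]
    simp [hint]
  have hcheb := meas_ge_le_variance_div_sq (memLp_finsetSum' _ hmem) (mul_pos hn' hε)
  rw [hmean] at hcheb
  have hset : {ω | ε ≤ |(∑ i, (E i).indicator (1 : Ω → ℝ) ω) / n - q|} =
      {ω | n * ε ≤ |(∑ i, (E i).indicator (1 : Ω → ℝ)) ω - n * q|} := by
    ext ω
    have : (∑ i, (E i).indicator (1 : Ω → ℝ) ω) - n * q =
        n * ((∑ i, (E i).indicator (1 : Ω → ℝ) ω) / n - q) := by field_simp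
    simp only [mem_ofPred_eq, Finset.sum_apply]
    rw [this, abs_mul, abs_of_pos hn', mul_le_mul_iff_right₀ hn']
  rw [hset]
  refine (ENNReal.toReal_mono ENNReal.ofReal_ne_top hcheb).trans ?_
  rw [ENNReal.toReal_ofReal (div_nonneg (variance_nonneg _ _) (sq_nonneg _))]
  calc _ ≤ (n : ℝ) / (n * ε) ^ 2 := by gcongr
    _ = _ := by field_simp

/-- Cylinders over independent sets are independent under a product measure. -/
lemma indepSet_univ_pi {V : Type*} [MeasurableSpace V] (μ : Measure V) [IsProbabilityMeasure μ]
    (m : ℕ) {F G : Set V} (hF : MeasurableSet F) (hG : MeasurableSet G) (h : IndepSet F G μ) :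
    IndepSet (univ.pi fun _ : Fin m => F) (univ.pi fun _ => G) (Measure.pi fun _ => μ) := by
  refine (indepSet_iff_measure_inter_eq_mul (MeasurableSet.univ_pi fun _ => hF)
    (MeasurableSet.univ_pi fun _ => hG) _).2 ?_
  rw [← pi_inter_distrib, Measure.pi_pi, Measure.pi_pi,
    Measure.pi_pi, h.measure_inter_eq_mul, Finset.prod_mul_distrib]

/-- Distinct coordinates are independent under a product measure. -/
lemma indepFun_eval_pi {ι : Type*} [Fintype ι] {V : Type*} [MeasurableSpace V] (μ : Measure V)
    [IsProbabilityMeasure μ] {i j : ι} (hij : i ≠ j) :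
    IndepFun (fun v : ι → V => v i) (fun v => v j) (Measure.pi fun _ => μ) :=
  (iIndepFun_pi (X := fun _ : ι => (id : V → V)) fun _ => aemeasurable_id).indepFun hij

/-- A finite set of small diameter has a small `γ₁` functional. -/
lemma gamma1_euclDist_le {d : ℕ} {A : Set (Fin d → ℝ)} (hA : A.Finite) (hne : A.Nonempty)
    {S : ℕ} (hS : A.ncard ≤ 2 ^ 2 ^ S) {r : ℝ} (hr : 0 ≤ r)
    (hdist : ∀ x ∈ A, ∀ y ∈ A, euclDist x y ≤ r) :
    gamma1 euclDist A ≤ 2 ^ (S + 1) * r := by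
  obtain ⟨x₀, hx₀⟩ := hne
  have hbdd : ∀ (h : Fin d → ℝ) (T : Set (Fin d → ℝ)), BddBelow (euclDist h '' T) :=
    fun h T => ⟨0, by rintro _ ⟨y, -, rfl⟩; exact Real.sqrt_nonneg _⟩
  refine csInf_le ⟨0, ?_⟩ ⟨fun s => if s ≤ S then {x₀} else A, ⟨?_, ?_, ?_, ?_, ?_⟩, ?_⟩
  · rintro b ⟨T, -, hb⟩
    simpa using hb x₀ hx₀ 0
  · intro s
    dsimp only
    split_ifs
    · simpa using hx₀
    · exact subset_rfl
  · intro s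
    dsimp only
    split_ifs
    · simp
    · exact hA
  · intro s
    dsimp only
    split_ifs
    · simp
    · exact ⟨x₀, hx₀⟩
  · simp
  · intro s _
    dsimp only
    split_ifs with h
    · simpa using Nat.one_le_two_pow
    · exact hS.trans (Nat.pow_le_pow_right two_pos (Nat.pow_le_pow_right two_pos (by omega)))
  · intro h hh n
    calc ∑ s ∈ Finset.range n, (2 : ℝ) ^ s * sInf (euclDist h '' if s ≤ S then {x₀} else A)
        ≤ ∑ s ∈ Finset.range n, if s ≤ S then (2 : ℝ) ^ s * r else 0 := by
          refine Finset.sum_le_sum fun s _ => ?_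
          split_ifs
          · rw [image_singleton, csInf_singleton]
            gcongr
            exact hdist h hh x₀ hx₀
          · refine mul_nonpos_of_nonneg_of_nonpos (by positivity) ?_
            exact csInf_le (hbdd h A) ⟨h, hh, by simp [euclDist]⟩
      _ = ∑ s ∈ (Finset.range n).filter (· ≤ S), (2 : ℝ) ^ s * r := by rw [Finset.sum_filter]
      _ ≤ ∑ s ∈ Finset.range (S + 1), (2 : ℝ) ^ s * r := by
          refine Finset.sum_le_sum_of_subset_of_nonneg (fun s hs => ?_) fun s _ _ => by positivity
          simp only [Finset.mem_filter, Finset.mem_range] at hs ⊢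
          omega
      _ ≤ 2 ^ (S + 1) * r := by
          rw [← Finset.sum_mul, geom_sum_eq (by norm_num)]
          gcongr
          norm_num

/-- A symmetric distribution charges `(-∞, 0]` with probability at least one half. -/
lemma half_le_measureReal_Iic_zero {ν : Measure ℝ} [IsProbabilityMeasure ν]
    (hsymm : Measure.map (fun t : ℝ => -t) ν = ν) : 1 / 2 ≤ ν.real (Iic 0) := by
  have h : ν.real (Ici 0) = ν.real (Iic 0) := by
    conv_rhs => rw [← hsymm, map_measureReal_apply measurable_neg measurableSet_Iic]
    congr 1
    ext t
    simp
  have hu : ν.real (Iic 0 ∪ Ici 0) ≤ ν.real (Iic 0) + ν.real (Ici 0) := measureReal_union_le _ _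
  rw [Iic_union_Ici, probReal_univ] at hu
  linarith

/-- A symmetric distribution not concentrated at `0` charges `(0, ∞)`. -/
lemma measureReal_Ioi_zero_pos {ν : Measure ℝ} [IsProbabilityMeasure ν]
    (hsymm : Measure.map (fun t : ℝ => -t) ν = ν) {a : ℝ} (ha : 0 < a)
    (hpos : ν {t : ℝ | a ≤ |t|} ≠ 0) : 0 < ν.real (Ioi 0) := by
  have h : ν (Iio 0) = ν (Ioi 0) := by
    conv_rhs => rw [← hsymm, Measure.map_apply measurable_neg measurableSet_Ioi]
    congr 1
    ext t
    simp
  have hsub : {t : ℝ | a ≤ |t|} ⊆ Iio 0 ∪ Ioi 0 := fun t ht => by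
    have : t ≠ 0 := abs_pos.1 (ha.trans_le ht)
    exact lt_or_gt_of_ne this
  rw [measureReal_def, ENNReal.toReal_pos_iff]
  refine ⟨pos_iff_ne_zero.2 fun h0 => hpos ?_, measure_lt_top _ _⟩
  exact measure_mono_null hsub (measure_union_null (h.trans h0) h0)

/-- For a vanishing perturbation `δ w₂` of `w₁`, the distribution function at an atom `t₀` of
size `η` retains at least (almost) the part of the atom on which `w₂ ≤ 0`. -/
lemma eventually_le_measureReal_add_mul_le {ν : Measure ℝ} [IsProbabilityMeasure ν] (t₀ : ℝ)
    {c : ℝ} (hc : c < ν.real (Iio t₀) + ν.real {t₀} * ν.real (Iic 0)) :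
    ∀ᶠ n : ℕ in atTop, c ≤ (ν.prod ν).real {p | p.1 + 1 / ((n : ℝ) + 1) * p.2 ≤ t₀} := by
  set U : ℕ → Set (ℝ × ℝ) := fun n =>
    {p | p.1 + 1 / ((n : ℝ) + 1) * |p.2| < t₀} ∪ {t₀} ×ˢ Iic 0 with hU
  have hmono : Monotone U := fun n k hnk p hp => by
    rcases hp with hp | hp
    · refine Or.inl (lt_of_le_of_lt ?_ (mem_ofPred_eq ▸ hp))
      gcongr
    · exact Or.inr hp
  have hunion : Iio t₀ ×ˢ univ ∪ {t₀} ×ˢ Iic 0 ⊆ ⋃ n, U n := by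
    rintro p (hp | hp)
    · have hlim : Tendsto (fun n : ℕ => p.1 + 1 / ((n : ℝ) + 1) * |p.2|) atTop
          (𝓝 (p.1 + 0 * |p.2|)) :=
        (tendsto_one_div_add_atTop_nhds_zero_nat.mul_const _).const_add _
      have hlt : p.1 + 0 * |p.2| < t₀ := by simpa using hp
      obtain ⟨n, hn⟩ := (hlim.eventually_lt_const hlt).exists
      exact mem_iUnion.2 ⟨n, Or.inl hn⟩
    · exact mem_iUnion.2 ⟨0, Or.inr hp⟩
  have hval : (ν.prod ν).real (Iio t₀ ×ˢ univ ∪ {t₀} ×ˢ Iic 0) =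
      ν.real (Iio t₀) + ν.real {t₀} * ν.real (Iic 0) := by
    rw [measureReal_union _ ((measurableSet_singleton _).prod measurableSet_Iic),
      measureReal_prod_prod, measureReal_prod_prod, probReal_univ, mul_one]
    exact Set.disjoint_prod.2 (Or.inl (by simp))
  have hlim : Tendsto (fun n => (ν.prod ν).real (U n)) atTop (𝓝 ((ν.prod ν).real (⋃ n, U n))) :=
    (ENNReal.tendsto_toReal (measure_ne_top _ _)).comp (tendsto_measure_iUnion_atTop hmono)
  have hlt : c < (ν.prod ν).real (⋃ n, U n) :=
    hc.trans_le (hval ▸ measureReal_mono hunion)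
  filter_upwards [hlim.eventually_const_lt hlt] with n hn
  refine hn.le.trans (measureReal_mono ?_)
  have hδ : (0 : ℝ) ≤ 1 / ((n : ℝ) + 1) := by positivity
  rintro p (hp | ⟨hp, hp'⟩)
  · exact (add_le_add_right (mul_le_mul_of_nonneg_left (le_abs_self p.2) hδ) _).trans
      (le_of_lt hp)
  · have hp : p.1 = t₀ := hp
    have hp' : p.2 ≤ 0 := hp'
    have := mul_nonpos_of_nonneg_of_nonpos hδ hp'
    change p.1 + 1 / ((n : ℝ) + 1) * p.2 ≤ t₀
    linarith

/-- The vector `r • (e₀ + δ • e_{j+1})`. -/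
def perturbedAxis {N : ℕ} (r δ : ℝ) (j : Fin N) : Fin (N + 1) → ℝ :=
  Fin.cons r (Pi.single j (r * δ))

lemma dotp_perturbedAxis {N : ℕ} (r δ : ℝ) (j : Fin N) (v : Fin (N + 1) → ℝ) :
    dotp v (perturbedAxis r δ j) = r * (v 0 + δ * v j.succ) := by
  simp only [dotp, perturbedAxis, Fin.sum_univ_succ, Fin.cons_zero, Fin.cons_succ,
    Pi.single_apply, mul_ite, mul_zero, Finset.sum_ite_eq', Finset.mem_univ,
    if_true]
  ring

lemma perturbedAxis_mem_unitSphere {N : ℕ} {r δ : ℝ} (h : r ^ 2 * (1 + δ ^ 2) = 1) (j : Fin N) :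
    perturbedAxis r δ j ∈ unitSphere (N + 1) := by
  change ∑ i, (perturbedAxis r δ j i) ^ 2 = 1
  have : ∑ i, (perturbedAxis r δ j i) ^ 2 = dotp (perturbedAxis r δ j) (perturbedAxis r δ j) :=
    Finset.sum_congr rfl fun i _ => sq _
  rw [this, dotp_perturbedAxis]
  simp only [perturbedAxis, Fin.cons_zero, Fin.cons_succ, Pi.single_eq_same]
  linarith

lemma euclDist_perturbedAxis_le {N : ℕ} {r δ : ℝ} (hr : 0 ≤ r) (hδ : 0 ≤ δ) (j k : Fin N) :
    euclDist (perturbedAxis r δ j) (perturbedAxis r δ k) ≤ 2 * (r * δ) := by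
  refine Real.sqrt_le_iff.2 ⟨by positivity, ?_⟩
  calc ∑ i, (perturbedAxis r δ j i - perturbedAxis r δ k i) ^ 2
      = ∑ i : Fin N, (Pi.single j (r * δ) i - Pi.single k (r * δ) i) ^ 2 := by
        simp [Fin.sum_univ_succ, perturbedAxis]
    _ ≤ ∑ i : Fin N, (2 * (Pi.single (M := fun _ => ℝ) j (r * δ) i) ^ 2 +
          2 * (Pi.single (M := fun _ => ℝ) k (r * δ) i) ^ 2) := by
        refine Finset.sum_le_sum fun i _ => ?_
        nlinarith [sq_nonneg (Pi.single (M := fun _ => ℝ) j (r * δ) i +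
          Pi.single (M := fun _ => ℝ) k (r * δ) i)]
    _ = (2 * (r * δ)) ^ 2 := by
        simp only [Finset.sum_add_distrib, Pi.single_apply, ite_pow, mul_ite, Finset.sum_ite_eq',
          Finset.mem_univ, if_true, ne_eq, OfNat.ofNat_ne_zero,
          not_false_eq_true, zero_pow, mul_zero]
        ring

lemma empCDF_nonneg {m : ℕ} (xs : Fin m → ℝ) (t : ℝ) : 0 ≤ empCDF xs t := by
  unfold empCDF
  positivity

lemma empCDF_le_one {m : ℕ} (xs : Fin m → ℝ) (t : ℝ) : empCDF xs t ≤ 1 := by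
  refine div_le_one_of_le₀ ?_ (by positivity)
  exact_mod_cast (Finset.card_le_univ _).trans_eq (Fintype.card_fin m)

/-- A nested real supremum of a bounded nonnegative family dominates each of its members. -/
lemma le_biSup_iSup {α : Type*} {A : Set α} {f : α → ℝ → ℝ} {b : ℝ} (h0 : ∀ x t, 0 ≤ f x t)
    (hb : ∀ x t, f x t ≤ b) {x : α} (hx : x ∈ A) (t : ℝ) :
    f x t ≤ ⨆ x ∈ A, ⨆ t : ℝ, f x t := by
  have hb0 : 0 ≤ b := (h0 x t).trans (hb x t)
  have hbdd : BddAbove (range fun y => ⨆ _ : y ∈ A, ⨆ t : ℝ, f y t) :=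
    ⟨b, by
      rintro _ ⟨y, rfl⟩
      exact Real.iSup_le (fun _ => Real.iSup_le (hb y) hb0) hb0⟩
  calc f x t ≤ ⨆ t : ℝ, f x t := le_ciSup ⟨b, by rintro _ ⟨s, rfl⟩; exact hb x s⟩ t
    _ = ⨆ _ : x ∈ A, ⨆ t : ℝ, f x t := by simp [hx]
    _ ≤ _ := le_ciSup hbdd x

lemma cdfOf_pi_perturbedAxis {N : ℕ} (ν : Measure ℝ) [IsProbabilityMeasure ν] {r : ℝ}
    (hr : 0 < r) (δ t₀ : ℝ) (j : Fin N) :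
    cdfOf (Measure.pi fun _ : Fin (N + 1) => ν) (fun v => dotp v (perturbedAxis r δ j)) (r * t₀) =
      (ν.prod ν).real {p | p.1 + δ * p.2 ≤ t₀} := by
  have hmap : (Measure.pi fun _ : Fin (N + 1) => ν).map (fun v => (v 0, v j.succ)) =
      ν.prod ν := by
    rw [(indepFun_iff_map_prod_eq_prod_map_map (measurable_pi_apply _).aemeasurable
      (measurable_pi_apply _).aemeasurable).1
      (indepFun_eval_pi ν (Fin.succ_ne_zero j).symm)]
    rw [(measurePreserving_eval (fun _ : Fin (N + 1) => ν) 0).map_eq,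
      (measurePreserving_eval (fun _ : Fin (N + 1) => ν) j.succ).map_eq]
  rw [← hmap, map_measureReal_apply (by fun_prop)
    (measurableSet_le (by fun_prop) measurable_const)]
  simp only [cdfOf, dotp_perturbedAxis, mul_le_mul_iff_right₀ hr]
  rfl

/-- If all perturbations are positive, only sample points below `t₀` are counted at `t₀`. -/
lemma empCDF_perturbedAxis_le {m N : ℕ} {r δ t₀ : ℝ} (hr : 0 < r) (hδ : 0 < δ) {j : Fin N}
    {ω : Fin m → Fin (N + 1) → ℝ} (hω : ∀ i, 0 < ω i j.succ) :
    empCDF (fun i => dotp (ω i) (perturbedAxis r δ j)) (r * t₀) ≤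
      (∑ i, {ω : Fin m → Fin (N + 1) → ℝ | ω i 0 < t₀}.indicator 1 ω) / (m : ℝ) := by
  have hsum : (∑ i, {ω : Fin m → Fin (N + 1) → ℝ | ω i 0 < t₀}.indicator
      (1 : (Fin m → Fin (N + 1) → ℝ) → ℝ) ω) =
      ((Finset.univ.filter fun i => ω i 0 < t₀).card : ℝ) := by
    simp [Set.indicator_apply]
  rw [hsum, empCDF]
  gcongr with i
  intro hi
  rw [dotp_perturbedAxis, mul_le_mul_iff_right₀ hr] at hi
  linarith [mul_pos hδ (hω i)]

/-- With high probability, the frequency of first coordinates below `t₀` is not too large. -/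
lemma measureReal_frequency_zero_gt_le {m N : ℕ} (hm : 0 < m) (ν : Measure ℝ)
    [IsProbabilityMeasure ν] (t₀ : ℝ) {ε : ℝ} (hε : 0 < ε) :
    (Measure.pi fun _ : Fin m => Measure.pi fun _ : Fin (N + 1) => ν).real
      {ω | ν.real (Iio t₀) + ε <
        (∑ i, {ω : Fin m → Fin (N + 1) → ℝ | ω i 0 < t₀}.indicator 1 ω) / (m : ℝ)} ≤
      1 / (m * ε ^ 2) := by
  have hF : MeasurableSet {v : Fin (N + 1) → ℝ | v 0 < t₀} :=
    measurableSet_lt (measurable_pi_apply _) measurable_const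
  refine le_trans (measureReal_mono ?_) (measureReal_abs_frequency_sub_ge_le _ hm
    (E := fun i => {ω : Fin m → Fin (N + 1) → ℝ | ω i 0 < t₀}) (q := ν.real (Iio t₀))
    (fun i => hF.preimage (measurable_pi_apply i)) (fun i => ?_) (fun i k hik => ?_) hε)
  · intro ω hω
    rw [mem_ofPred_eq] at hω ⊢
    refine le_trans ?_ (le_abs_self _)
    linarith
  · exact ((measurePreserving_eval (fun _ : Fin (N + 1) => ν) 0).comp
      (measurePreserving_eval (fun _ : Fin m => Measure.pi fun _ : Fin (N + 1) => ν) i)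
      ).measureReal_preimage measurableSet_Iio.nullMeasurableSet
  · exact (indepFun_iff_indepSet_preimage (measurable_pi_apply i) (measurable_pi_apply k)).1
      (indepFun_eval_pi (Measure.pi fun _ : Fin (N + 1) => ν) hik) _ _ hF hF

/-- With high probability, in large dimension some coordinate is positive on the whole sample. -/
lemma measureReal_forall_exists_nonpos_le {m N : ℕ} (hN : 0 < N) (ν : Measure ℝ)
    [IsProbabilityMeasure ν] (hp : 0 < ν.real (Ioi 0)) :
    (Measure.pi fun _ : Fin m => Measure.pi fun _ : Fin (N + 1) => ν).real
      {ω | ∀ j : Fin N, ∃ i, ω i j.succ ≤ 0} ≤ 1 / (N * (ν.real (Ioi 0) ^ m) ^ 2) := by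
  have hF : ∀ j : Fin N, MeasurableSet {v : Fin (N + 1) → ℝ | 0 < v j.succ} := fun j =>
    measurableSet_lt measurable_const (measurable_pi_apply _)
  refine le_trans (measureReal_mono ?_) (measureReal_abs_frequency_sub_ge_le _ hN
    (E := fun j => univ.pi fun _ : Fin m => {v : Fin (N + 1) → ℝ | 0 < v j.succ})
    (q := ν.real (Ioi 0) ^ m) (fun j => MeasurableSet.univ_pi fun _ => hF j) (fun j => ?_)
    (fun j k hjk => ?_) (pow_pos hp m))
  · intro ω hω
    have h0 : ∀ j : Fin N, (univ.pi fun _ : Fin m =>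
        {v : Fin (N + 1) → ℝ | 0 < v j.succ}).indicator
          (1 : (Fin m → Fin (N + 1) → ℝ) → ℝ) ω = 0 := fun j => by
      refine indicator_of_notMem (fun hmem => ?_) _
      obtain ⟨i, hi⟩ := hω j
      exact (not_lt.2 hi) (hmem i (mem_univ i))
    simp only [mem_ofPred_eq, h0, Finset.sum_const_zero, zero_div, zero_sub, abs_neg]
    exact le_abs_self _
  · have := (measurePreserving_eval (fun _ : Fin (N + 1) => ν) j.succ).measure_preimage
      measurableSet_Ioi.nullMeasurableSet (s := Ioi (0 : ℝ))
    change (Measure.pi fun _ : Fin (N + 1) => ν) {v | 0 < v j.succ} = _ at this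
    simp [measureReal_def, Measure.pi_pi, this]
  · exact indepSet_univ_pi _ m (hF j) (hF k)
      ((indepFun_iff_indepSet_preimage (measurable_pi_apply _) (measurable_pi_apply _)).1
        (indepFun_eval_pi ν ((Fin.succ_injective N).ne hjk)) _ _ measurableSet_Ioi
          measurableSet_Ioi)

/-- **Lemma 1.11**: if the coordinate distribution `w ∼ ν` (symmetric, variance 1,
nontrivial) has an atom of size `η`, then for every `m ≥ c₁/η²` there are a dimension `d`
and a set `A ⊆ S^{d-1}` with `γ₁(A) ≤ 10` on which the uniform DKW inequality fails at
level `c₂ η`, for the random vector `X` with iid coordinates distributed as `w`. -/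
theorem atom_obstruction :
    ∃ c₁ c₂ : ℝ, 0 < c₁ ∧ 0 < c₂ ∧
      ∀ (ν : Measure ℝ) [IsProbabilityMeasure ν],
        -- `w` is symmetric with variance 1 and `ℙ(|w| ≥ 0.1) ≥ 0.1`:
        Measure.map (fun t : ℝ => -t) ν = ν →
        (∫ t, t ^ 2 ∂ν) = 1 →
        ENNReal.ofReal 0.1 ≤ ν {t : ℝ | 0.1 ≤ |t|} →
        -- `w` has an atom of size `η`:
        ∀ (η t₀ : ℝ), 0 < η → ν {t₀} = ENNReal.ofReal η →
        ∀ m : ℕ, c₁ / η ^ 2 ≤ m →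
        ∃ (d : ℕ) (A : Set (Fin d → ℝ)),
          A ⊆ unitSphere d ∧ gamma1 euclDist A ≤ 10 ∧
          ENNReal.ofReal 0.9 ≤
            (Measure.pi fun _ : Fin m => (Measure.pi fun _ : Fin d => ν))
              {ω | c₂ * η ≤ ⨆ x ∈ A, ⨆ t : ℝ,
                |empCDF (fun i => dotp (ω i) x) t -
                  cdfOf (Measure.pi fun _ : Fin d => ν) (fun v => dotp v x) t|} := by
  refine ⟨2000, 1 / 4, by norm_num, by norm_num, ?_⟩
  intro ν _ hsymm _ hnontriv η t₀ hη hatom m hm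
  have hmR : (0 : ℝ) < m := lt_of_lt_of_le (by positivity) hm
  have hmη : 2000 ≤ (m : ℝ) * η ^ 2 := (div_le_iff₀ (by positivity)).1 hm
  have hp : 0 < ν.real (Ioi 0) := by
    refine measureReal_Ioi_zero_pos hsymm (a := 0.1) (by norm_num) fun h0 => ?_
    rw [h0] at hnontriv
    norm_num at hnontriv
  have hatom' : ν.real {t₀} = η := by
    rw [measureReal_def, hatom, ENNReal.toReal_ofReal hη.le]
  obtain ⟨N, hNlarge⟩ := exists_nat_gt (20 / (ν.real (Ioi 0) ^ m) ^ 2)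
  have hNR : (0 : ℝ) < N := lt_of_le_of_lt (by positivity) hNlarge
  have hN : 0 < N := by exact_mod_cast hNR
  have hc : ν.real (Iio t₀) + 3 / 8 * η < ν.real (Iio t₀) + ν.real {t₀} * ν.real (Iic 0) := by
    rw [hatom']
    nlinarith [half_le_measureReal_Iic_zero hsymm]
  have hsmall : ∀ᶠ n : ℕ in atTop, 1 / ((n : ℝ) + 1) < 5 / 2 ^ (N + 1) :=
    tendsto_one_div_add_atTop_nhds_zero_nat.eventually_lt_const (by positivity)
  obtain ⟨n, hcdf, hδsmall⟩ := ((eventually_le_measureReal_add_mul_le t₀ hc).and hsmall).exists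
  have hδ : 0 < 1 / ((n : ℝ) + 1) := by positivity
  set δ : ℝ := 1 / ((n : ℝ) + 1)
  set r : ℝ := 1 / √(1 + δ ^ 2) with hr_def
  have hr : 0 < r := by positivity
  have hr2 : r ^ 2 * (1 + δ ^ 2) = 1 := by
    rw [hr_def, div_pow, Real.sq_sqrt (by positivity)]
    field_simp
  have hr1 : r ≤ 1 := by
    refine div_le_one_of_le₀ (Real.one_le_sqrt.2 ?_) (Real.sqrt_nonneg _)
    nlinarith
  refine ⟨N + 1, range fun j : Fin N => perturbedAxis r δ j, ?_, ?_, ?_⟩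
  · rintro _ ⟨j, rfl⟩
    exact perturbedAxis_mem_unitSphere hr2 j
  · have hcard : (range fun j : Fin N => perturbedAxis r δ j).ncard ≤ 2 ^ 2 ^ N := by
      rw [← image_univ]
      refine (ncard_image_le finite_univ).trans ?_
      rw [ncard_univ, Nat.card_eq_fintype_card, Fintype.card_fin]
      exact Nat.lt_two_pow_self.le.trans Nat.lt_two_pow_self.le
    refine (gamma1_euclDist_le (finite_range _) ⟨_, ⟨⟨0, hN⟩, rfl⟩⟩ hcard (r := 2 * (r * δ))
      (by positivity) ?_).trans ?_
    · rintro _ ⟨j, rfl⟩ _ ⟨k, rfl⟩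
      exact euclDist_perturbedAxis_le hr.le hδ.le j k
    · have h1 : r * δ ≤ 5 / 2 ^ (N + 1) := by nlinarith
      calc (2 : ℝ) ^ (N + 1) * (2 * (r * δ)) ≤ 2 ^ (N + 1) * (2 * (5 / 2 ^ (N + 1))) := by gcongr
        _ = 10 := by field_simp; norm_num
  · set P := Measure.pi fun _ : Fin m => Measure.pi fun _ : Fin (N + 1) => ν
    set good := {ω : Fin m → Fin (N + 1) → ℝ | 1 / 4 * η ≤
      ⨆ x ∈ range fun j : Fin N => perturbedAxis r δ j, ⨆ t : ℝ,
        |empCDF (fun i => dotp (ω i) x) t -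
          cdfOf (Measure.pi fun _ : Fin (N + 1) => ν) (fun v => dotp v x) t|}
    set C := {ω : Fin m → Fin (N + 1) → ℝ | ν.real (Iio t₀) + η / 8 <
      (∑ i, {ω : Fin m → Fin (N + 1) → ℝ | ω i 0 < t₀}.indicator 1 ω) / (m : ℝ)}
    set B := {ω : Fin m → Fin (N + 1) → ℝ | ∀ j : Fin N, ∃ i, ω i j.succ ≤ 0}
    have hC : P.real C ≤ 0.05 := by
      refine (measureReal_frequency_zero_gt_le (by exact_mod_cast hmR) ν t₀
        (by positivity : 0 < η / 8)).trans ?_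
      rw [div_le_iff₀ (by positivity)]
      nlinarith
    have hB : P.real B ≤ 0.05 := by
      refine (measureReal_forall_exists_nonpos_le hN ν hp).trans ?_
      rw [div_lt_iff₀ (by positivity)] at hNlarge
      rw [div_le_iff₀ (by positivity)]
      linarith
    have hcover : univ ⊆ good ∪ (C ∪ B) := by
      intro ω _
      by_cases hωC : ω ∈ C
      · exact Or.inr (Or.inl hωC)
      by_cases hωB : ω ∈ B
      · exact Or.inr (Or.inr hωB)
      left
      obtain ⟨j, hj⟩ : ∃ j : Fin N, ∀ i, 0 < ω i j.succ := by
        simpa [B] using hωB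
      have hC' := not_lt.1 (mem_ofPred_eq ▸ hωC)
      have hemp := (empCDF_perturbedAxis_le (t₀ := t₀) hr hδ hj).trans hC'
      rw [← cdfOf_pi_perturbedAxis ν hr δ t₀ j] at hcdf
      refine le_trans ?_ (le_biSup_iSup (b := 1) (fun _ _ => abs_nonneg _) (fun x t => ?_)
        (mem_range_self j) (r * t₀))
      · rw [abs_sub_comm]
        exact le_trans (by linarith) (le_abs_self _)
      · have h1 : cdfOf (Measure.pi fun _ : Fin (N + 1) => ν) (fun v => dotp v x) t ≤ 1 :=
          measureReal_le_one
        have h2 : 0 ≤ cdfOf (Measure.pi fun _ : Fin (N + 1) => ν) (fun v => dotp v x) t :=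
          ENNReal.toReal_nonneg
        have h3 := empCDF_nonneg (fun i => dotp (ω i) x) t
        have h4 := empCDF_le_one (fun i => dotp (ω i) x) t
        exact abs_sub_le_iff.2 ⟨by linarith, by linarith⟩
    have htotal : 1 ≤ P.real good + (P.real C + P.real B) := by
      calc (1 : ℝ) = P.real univ := probReal_univ.symm
        _ ≤ P.real (good ∪ (C ∪ B)) := measureReal_mono hcover
        _ ≤ P.real good + P.real (C ∪ B) := measureReal_union_le _ _
        _ ≤ _ := by gcongr; exact measureReal_union_le _ _
    refine ENNReal.ofReal_le_of_le_toReal ?_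
    change (0.9 : ℝ) ≤ P.real good
    norm_num at hC hB ⊢
    linarith
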